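/- arXiv:1906.06777 — 4 statements merged into one kernel-verified Lean document; each statement's English description precedes it below -/
import Mathlib

section
/- Let K be a field and let m, p be positive integers. Let S, T be m×p binary matrices with T ≤ S, and let R be a p×p reflexive binary matrix such that T·R^{p-1} ≤ S (Boolean product and power). Then for every m×p matrix Y over K with Y ∈ Sparse(T) and every invertible p×p matrix X over K with X ∈ Sparse(R), the product Y·X⁻¹ lies in Sparse(S). (Sufficiency direction of the Sparsity Invariance characterization, Theorem 1.) -/
/-- Boolean (logical) matrix product. -/
def bmul {m p q : ℕ} (A : Matrix (Fin m) (Fin p) Bool) (B : Matrix (Fin p) (Fin q) Bool) :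
    Matrix (Fin m) (Fin q) Bool :=
  fun i k => decide (∃ j, A i j = true ∧ B j k = true)

/-- Identity binary matrix. -/
def bId (p : ℕ) : Matrix (Fin p) (Fin p) Bool := fun i j => decide (i = j)

/-- Boolean (entrywise OR) sum of binary matrices. -/
def badd {m p : ℕ} (A B : Matrix (Fin m) (Fin p) Bool) : Matrix (Fin m) (Fin p) Bool :=
  fun i j => A i j || B i j

/-- k-fold Boolean power (bpow R 0 = identity). -/
def bpow {p : ℕ} (R : Matrix (Fin p) (Fin p) Bool) : ℕ → Matrix (Fin p) (Fin p) Bool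
  | 0 => bId p
  | k + 1 => bmul (bpow R k) R

/-- Entrywise order on binary matrices. -/
def bLE {m p : ℕ} (A B : Matrix (Fin m) (Fin p) Bool) : Prop :=
  ∀ i j, A i j = true → B i j = true

/-- A square binary matrix is reflexive if all diagonal entries are 1. -/
def BRefl {p : ℕ} (R : Matrix (Fin p) (Fin p) Bool) : Prop := ∀ i, R i i = true

/-- Y ∈ Sparse(T): Y vanishes wherever the pattern T is zero. -/
def Sparse {K : Type*} [Field K] {m p : ℕ} (T : Matrix (Fin m) (Fin p) Bool)
    (Y : Matrix (Fin m) (Fin p) K) : Prop :=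
  ∀ i j, T i j = false → Y i j = 0

theorem bpow_mono_of_refl {p : ℕ} {R : Matrix (Fin p) (Fin p) Bool} (hR : BRefl R) {k l : ℕ}
    (hkl : k ≤ l) : bLE (bpow R k) (bpow R l) := by
  induction l, hkl using Nat.le_induction with
  | base => exact fun _ _ h => h
  | succ l _ ih =>
    intro i j h
    exact decide_eq_true ⟨j, ih i j h, hR j⟩

section Sparse

variable {K : Type*} [Field K] {m p q : ℕ}

theorem Sparse.mono {A B : Matrix (Fin m) (Fin p) Bool} (h : bLE A B)
    {Y : Matrix (Fin m) (Fin p) K} (hY : Sparse A Y) : Sparse B Y := by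
  intro i j hB
  refine hY i j (Bool.eq_false_iff.mpr fun hA => ?_)
  simp [h i j hA] at hB

theorem Sparse.mul {A : Matrix (Fin m) (Fin p) Bool} {B : Matrix (Fin p) (Fin q) Bool}
    {Y : Matrix (Fin m) (Fin p) K} {Z : Matrix (Fin p) (Fin q) K}
    (hY : Sparse A Y) (hZ : Sparse B Z) : Sparse (bmul A B) (Y * Z) := by
  intro i k h
  rw [Matrix.mul_apply]
  refine Finset.sum_eq_zero fun j _ => ?_
  have hj : ¬ (A i j = true ∧ B j k = true) := fun hj => of_decide_eq_false h ⟨j, hj⟩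
  by_cases hA : A i j = true
  · rw [hZ j k (Bool.eq_false_iff.mpr fun hB => hj ⟨hA, hB⟩), mul_zero]
  · rw [hY i j (Bool.eq_false_iff.mpr hA), zero_mul]

theorem Sparse.smul {A : Matrix (Fin m) (Fin p) Bool} {Y : Matrix (Fin m) (Fin p) K}
    (c : K) (hY : Sparse A Y) : Sparse A (c • Y) := by
  intro i j h
  simp [hY i j h]

theorem Sparse.sum {ι : Type*} {s : Finset ι} {A : Matrix (Fin m) (Fin p) Bool}
    {Y : ι → Matrix (Fin m) (Fin p) K} (hY : ∀ a ∈ s, Sparse A (Y a)) :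
    Sparse A (∑ a ∈ s, Y a) := by
  intro i j h
  rw [Matrix.sum_apply]
  exact Finset.sum_eq_zero fun a ha => hY a ha i j h

theorem Sparse.pow {R : Matrix (Fin p) (Fin p) Bool} {X : Matrix (Fin p) (Fin p) K}
    (hX : Sparse R X) (k : ℕ) : Sparse (bpow R k) (X ^ k) := by
  induction k with
  | zero =>
    intro i j h
    rw [pow_zero, Matrix.one_apply_ne (of_decide_eq_false h)]
  | succ k ih =>
    rw [pow_succ]
    exact ih.mul hX

end Sparse

/-- By Cayley–Hamilton, the inverse is a polynomial in the matrix. -/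
theorem Matrix.inv_eq_smul_aeval_divX_charpoly {K n : Type*} [Field K] [Fintype n]
    [DecidableEq n] {X : Matrix n n K} (hX : IsUnit X.det) :
    X⁻¹ = (-(X.charpoly.coeff 0)⁻¹) • Polynomial.aeval X X.charpoly.divX := by
  have hc : X.charpoly.coeff 0 ≠ 0 := by
    intro h
    rw [Matrix.det_eq_sign_charpoly_coeff, h, mul_zero] at hX
    exact not_isUnit_zero hX
  have h := X.aeval_self_charpoly
  rw [← Polynomial.divX_mul_X_add X.charpoly] at h
  simp only [map_add, map_mul, Polynomial.aeval_X, Polynomial.aeval_C,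
    Algebra.algebraMap_eq_smul_one] at h
  apply Matrix.inv_eq_left_inv
  rw [Matrix.smul_mul, eq_neg_of_add_eq_zero_left h, neg_smul, smul_neg, neg_neg, smul_smul,
    inv_mul_cancel₀ hc, one_smul]

theorem Sparse.inv {K : Type*} [Field K] {p : ℕ} {R : Matrix (Fin p) (Fin p) Bool}
    (hR : BRefl R) {X : Matrix (Fin p) (Fin p) K} (hdet : IsUnit X.det) (hX : Sparse R X) :
    Sparse (bpow R (p - 1)) X⁻¹ := by
  rw [Matrix.inv_eq_smul_aeval_divX_charpoly hdet, Polynomial.aeval_eq_sum_range]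
  refine Sparse.smul _ (Sparse.sum fun k hk => Sparse.smul _ ?_)
  rw [Finset.mem_range, Polynomial.natDegree_divX_eq_natDegree_tsub_one,
    Matrix.charpoly_natDegree_eq_dim, Fintype.card_fin] at hk
  exact (hX.pow k).mono (bpow_mono_of_refl hR (by lia))

/-- Sufficiency direction of the Sparsity Invariance characterization. -/
theorem sparsity_invariance_sufficient {K : Type*} [Field K] {m p : ℕ}
    (hm : 0 < m) (hp : 0 < p)
    (S T : Matrix (Fin m) (Fin p) Bool) (R : Matrix (Fin p) (Fin p) Bool)
    (hTS : bLE T S) (hR : BRefl R) (hTRS : bLE (bmul T (bpow R (p - 1))) S) :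
    ∀ (Y : Matrix (Fin m) (Fin p) K), Sparse T Y →
      ∀ (X : Matrix (Fin p) (Fin p) K), IsUnit X.det → Sparse R X →
        Sparse S (Y * X⁻¹) := by
  exact fun _ hY _ hdet hX => (hY.mul (hX.inv hR hdet)).mono hTRS
end

section
/- Let K be an infinite field, let m, p be positive integers, let T be an m×p binary matrix and R a p×p binary matrix, and let W be a p×p matrix over K with Struct(W) = R (i.e. W_{kj} ≠ 0 iff R_{kj} = 1). Then there exists an m×p matrix Z over K with Z ∈ Sparse(T) such that Struct(Z·W) = T·R, where T·R is the Boolean product; i.e. (ZW)_{ij} ≠ 0 if and only if there exists k with T_{ik} = 1 and R_{kj} = 1. (Lemma A2.) -/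
/-- Finitely many nonzero polynomials over an infinite domain have a common non-root. -/
theorem exists_forall_eval_ne_zero {K ι : Type*} [CommRing K] [IsDomain K] [Infinite K]
    (s : Finset ι) (P : ι → Polynomial K) (hP : ∀ a ∈ s, P a ≠ 0) :
    ∃ x : K, ∀ a ∈ s, (P a).eval x ≠ 0 := by
  have hprod : ∏ a ∈ s, P a ≠ 0 := Finset.prod_ne_zero_iff.mpr hP
  obtain ⟨x, hx⟩ : ∃ x : K, (∏ a ∈ s, P a).eval x ≠ 0 := by
    by_contra! h
    exact hprod (Polynomial.funext fun x => by simpa using h x)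
  rw [Polynomial.eval_prod] at hx
  exact ⟨x, Finset.prod_ne_zero_iff.mp hx⟩

/-- Lemma A2. -/
theorem exists_Z_struct_mul_eq {K : Type*} [Field K] [Infinite K] {m p : ℕ}
    (hm : 0 < m) (hp : 0 < p)
    (T : Matrix (Fin m) (Fin p) Bool) (R : Matrix (Fin p) (Fin p) Bool)
    (W : Matrix (Fin p) (Fin p) K) (hW : ∀ k j, W k j ≠ 0 ↔ R k j = true) :
    ∃ Z : Matrix (Fin m) (Fin p) K, Sparse T Z ∧
      ∀ i j, (Z * W) i j ≠ 0 ↔ ∃ k, T i k = true ∧ R k j = true := by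
  classical
  let P : Fin m × Fin p → Polynomial K := fun a =>
    ∑ k : Fin p, Polynomial.monomial k (if T a.1 k = true then W k a.2 else 0)
  have hcoeff (a : Fin m × Fin p) (k : Fin p) :
      (P a).coeff k = if T a.1 k = true then W k a.2 else 0 := by
    simp [P, Polynomial.finsetSum_coeff, Polynomial.coeff_monomial, Fin.val_inj]
  obtain ⟨x, hx⟩ := exists_forall_eval_ne_zero
    (Finset.univ.filter fun a => P a ≠ 0) P (by simp)
  let Z : Matrix (Fin m) (Fin p) K := fun i k => if T i k = true then x ^ (k : ℕ) else 0
  have hZ (i : Fin m) (j : Fin p) : (Z * W) i j = (P (i, j)).eval x := by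
    rw [Matrix.mul_apply]
    simp only [P, Z, Polynomial.eval_finsetSum, Polynomial.eval_monomial]
    refine Finset.sum_congr rfl fun k _ => ?_
    split_ifs <;> ring
  refine ⟨Z, fun i j h => by simp [Z, h], fun i j => ⟨fun h => ?_, ?_⟩⟩
  · rw [Matrix.mul_apply] at h
    obtain ⟨k, -, hk⟩ := Finset.exists_ne_zero_of_sum_ne_zero h
    refine ⟨k, ?_, (hW k j).mp (right_ne_zero_of_mul hk)⟩
    by_contra hT
    simp [Z, hT] at hk
  · rintro ⟨k, hT, hR⟩
    rw [hZ]
    refine hx (i, j) ?_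
    simp only [Finset.mem_filter_univ]
    intro h0
    have := hcoeff (i, j) k
    rw [h0, Polynomial.coeff_zero, if_pos hT] at this
    exact (hW k j).mpr hR this.symm
end

section
/- Let T be an m×p binary matrix and define the p×p binary matrix R*_T by (R*_T)_{jk} = 0 if and only if there exists an index i with T_{ij} = 1 and T_{ik} = 0 (this is the output of Algorithm 1). Then: (i) R*_T is reflexive; (ii) T·R*_T ≤ T (Boolean product); (iii) T·(R*_T)^{p-1} ≤ T; and (iv) for every p×p reflexive binary matrix R with T·R^{p-1} ≤ T, one has R^{p-1} ≤ R*_T. (Theorem 2: correctness and dominance of Algorithm 1's output.) -/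
/-- Output of Algorithm 1: (R*_T)_{jk} = 0 iff ∃ i, T_{ij} = 1 and T_{ik} = 0. -/
def Rstar {m p : ℕ} (T : Matrix (Fin m) (Fin p) Bool) : Matrix (Fin p) (Fin p) Bool :=
  fun j k => !decide (∃ i, T i j = true ∧ T i k = false)

theorem Rstar_apply_eq_true {m p : ℕ} (T : Matrix (Fin m) (Fin p) Bool) (j k : Fin p) :
    Rstar T j k = true ↔ ∀ i, T i j = true → T i k = true := by
  simp [Rstar]

/-- `Rstar T` is the largest right multiplier preserving the pattern `T`. -/
theorem bLE_bmul_iff_bLE_Rstar {m p : ℕ} (T : Matrix (Fin m) (Fin p) Bool)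
    (R : Matrix (Fin p) (Fin p) Bool) : bLE (bmul T R) T ↔ bLE R (Rstar T) := by
  simp only [bLE, bmul, decide_eq_true_eq, Rstar_apply_eq_true]
  exact ⟨fun h j k hR i hT => h i k ⟨j, hT, hR⟩, fun h i k ⟨j, hT, hR⟩ => h j k hR i hT⟩

theorem bpow_Rstar_bLE {m p : ℕ} (T : Matrix (Fin m) (Fin p) Bool) (n : ℕ) :
    bLE (bpow (Rstar T) n) (Rstar T) := by
  induction n with
  | zero =>
    intro j k h
    obtain rfl : j = k := by simpa [bpow, bId] using h
    simp [Rstar_apply_eq_true]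
  | succ n ih =>
    intro j k h
    obtain ⟨l, hjl, hlk⟩ : ∃ l, bpow (Rstar T) n j l = true ∧ Rstar T l k = true := by
      simpa [bpow, bmul] using h
    rw [Rstar_apply_eq_true] at hlk ⊢
    exact fun i hi => hlk i ((Rstar_apply_eq_true T j l).1 (ih j l hjl) i hi)

/-- Theorem 2, correctness and dominance of Algorithm 1's output. -/
theorem Rstar_correct_and_dominant {m p : ℕ} (T : Matrix (Fin m) (Fin p) Bool) :
    BRefl (Rstar T) ∧
    bLE (bmul T (Rstar T)) T ∧
    bLE (bmul T (bpow (Rstar T) (p - 1))) T ∧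
    ∀ R : Matrix (Fin p) (Fin p) Bool, BRefl R → bLE (bmul T (bpow R (p - 1))) T →
      bLE (bpow R (p - 1)) (Rstar T) := by
  refine ⟨fun j => ?_, ?_, ?_, fun R _ hR => (bLE_bmul_iff_bLE_Rstar T _).1 hR⟩
  · exact (Rstar_apply_eq_true T j j).2 fun _ h => h
  · exact (bLE_bmul_iff_bLE_Rstar T _).2 fun _ _ h => h
  · exact (bLE_bmul_iff_bLE_Rstar T _).2 (bpow_Rstar_bLE T (p - 1))
end

section
/- Let K be a field, let S be an m×p binary matrix and Δ a p×m binary matrix such that S·Δ·S ≤ S (Boolean products), and define R*_S by (R*_S)_{jk} = 0 iff there exists an index i with S_{ij} = 1 and S_{ik} = 0. Then for every p×m matrix G over K with G ∈ Sparse(Δ) and every m×p matrix Y over K with Y ∈ Sparse(S), the matrix I_p + G·Y lies in Sparse(R*_S). (Core of Corollary 3: under quadratic invariance, the constraint X_Q ∈ Sparse(R*_S) is automatically satisfied since X_Q = I_p + G·Y_Q.) -/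
/-- core of Corollary 3. -/
theorem one_add_GY_sparse_Rstar {K : Type*} [Field K] {m p : ℕ}
    (S : Matrix (Fin m) (Fin p) Bool) (Δ : Matrix (Fin p) (Fin m) Bool)
    (hQI : bLE (bmul (bmul S Δ) S) S)
    (G : Matrix (Fin p) (Fin m) K) (hG : Sparse Δ G)
    (Y : Matrix (Fin m) (Fin p) K) (hY : Sparse S Y) :
    Sparse (Rstar S) (1 + G * Y) := by
  intro j k hjk
  obtain ⟨i, hij, hik⟩ : ∃ i, S i j = true ∧ S i k = false := by
    simpa only [Rstar, Bool.not_eq_false', decide_eq_true_eq] using hjk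
  have hne : j ≠ k := by
    rintro rfl
    simp [hij] at hik
  rw [Matrix.add_apply, Matrix.one_apply_ne hne, zero_add, Matrix.mul_apply]
  refine Finset.sum_eq_zero fun l _ => ?_
  cases hΔ : Δ j l with
  | false => rw [hG j l hΔ, zero_mul]
  | true =>
    cases hS : S l k with
    | false => rw [hY l k hS, mul_zero]
    | true =>
      have hSik : S i k = true :=
        hQI i k (decide_eq_true ⟨l, decide_eq_true ⟨j, hij, hΔ⟩, hS⟩)
      simp [hSik] at hik
end
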